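/- For 0<q<p≤1, n∈ℕ with n≥1, and x≥0, the second moment of the (p,q)-Baskakov operator satisfies B_{n,p,q}(t²;x) = x² + (p^{n−1}x/[n]_{p,q})·(1+(p/q)x), i.e. Σ_{k=0}^∞ [n+k−1 choose k]_{p,q} p^{k+n(n−1)/2} q^{k(k−1)/2} (x^k/(1⊕x)^{n+k}_{p,q}) · (p^{n−1}[k]_{p,q}/(q^{k−1}[n]_{p,q}))² = x² + (p^{n−1}x/[n]_{p,q})(1+(p/q)x). -/

import Mathlib

open Real Set Filter

/-- The (p,q)-integer [n]_{p,q} = (p^n - q^n)/(p - q). -/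
noncomputable def pqInt (p q : ℝ) (n : ℕ) : ℝ := (p ^ n - q ^ n) / (p - q)

/-- The (p,q)-factorial [n]_{p,q}! . -/
noncomputable def pqFact (p q : ℝ) : ℕ → ℝ
  | 0 => 1
  | n + 1 => pqInt p q (n + 1) * pqFact p q n

/-- The (p,q)-binomial coefficient. -/
noncomputable def pqChoose (p q : ℝ) (n k : ℕ) : ℝ :=
  pqFact p q n / (pqFact p q k * pqFact p q (n - k))

/-- (1 ⊕ x)^n_{p,q} = ∏_{j=0}^{n-1} (p^j + q^j x). -/
noncomputable def pqOnePlusPow (p q x : ℝ) (n : ℕ) : ℝ :=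
  ∏ j ∈ Finset.range n, (p ^ j + q ^ j * x)

/-- The (p,q)-Baskakov operator B_{n,p,q}(f;x). -/
noncomputable def baskakov (p q : ℝ) (n : ℕ) (f : ℝ → ℝ) (x : ℝ) : ℝ :=
  ∑' k : ℕ, pqChoose p q (n + k - 1) k * p ^ (k + n * (n - 1) / 2) *
    q ^ (k * (k - 1) / 2) * (x ^ k / pqOnePlusPow p q x (n + k)) *
    f (p ^ (n - 1) * pqInt p q k / (q ^ (k - 1) * pqInt p q n))

/-- The function r_n(x) used in the King-type modification. -/
noncomputable def rn (p q : ℝ) (n : ℕ) (x : ℝ) : ℝ :=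
  (-(p ^ (n - 1)) +
      Real.sqrt (p ^ (2 * n - 2) + 4 * pqInt p q n * (pqInt p q n + p ^ n / q) * x ^ 2)) /
    (2 * (pqInt p q n + p ^ n / q))

/-- The King-type (p,q)-Baskakov operator B*_{n,p,q}(f;x) = B_{n,p,q}(f; r_n(x)). -/
noncomputable def kingBaskakov (p q : ℝ) (n : ℕ) (f : ℝ → ℝ) (x : ℝ) : ℝ :=
  baskakov p q n f (rn p q n x)

theorem pqInt_pos {p q : ℝ} (hq : 0 < q) (hqp : q < p) {n : ℕ} (hn : n ≠ 0) :
    0 < pqInt p q n :=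
  div_pos (sub_pos.2 (pow_lt_pow_left₀ hqp hq.le hn)) (sub_pos.2 hqp)

theorem pqInt_nonneg {p q : ℝ} (hq : 0 < q) (hqp : q < p) (n : ℕ) : 0 ≤ pqInt p q n :=
  div_nonneg (sub_nonneg.2 (pow_le_pow_left₀ hq.le hqp.le n)) (sub_pos.2 hqp).le

theorem pqInt_zero (p q : ℝ) : pqInt p q 0 = 0 := by simp [pqInt]

theorem pqInt_add {p q : ℝ} (hqp : q < p) (m n : ℕ) :
    pqInt p q (m + n) = p ^ m * pqInt p q n + q ^ n * pqInt p q m := by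
  have h : p - q ≠ 0 := (sub_pos.2 hqp).ne'
  unfold pqInt
  field_simp
  ring

theorem pqInt_one {p q : ℝ} (hqp : q < p) : pqInt p q 1 = 1 := by
  have h : p - q ≠ 0 := (sub_pos.2 hqp).ne'
  simp [pqInt, h]

theorem pqFact_pos {p q : ℝ} (hq : 0 < q) (hqp : q < p) (n : ℕ) : 0 < pqFact p q n := by
  induction n with
  | zero => exact one_pos
  | succ n ih => exact mul_pos (pqInt_pos hq hqp n.succ_ne_zero) ih

theorem pqOnePlusPow_pos {p q x : ℝ} (hq : 0 < q) (hqp : q < p) (hx : 0 ≤ x) (n : ℕ) :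
    0 < pqOnePlusPow p q x n :=
  Finset.prod_pos fun j _ =>
    add_pos_of_pos_of_nonneg (pow_pos (hq.trans hqp) j) (mul_nonneg (pow_pos hq j).le hx)

theorem pqOnePlusPow_succ (p q x : ℝ) (n : ℕ) :
    pqOnePlusPow p q x (n + 1) = pqOnePlusPow p q x n * (p ^ n + q ^ n * x) :=
  Finset.prod_range_succ _ _

theorem succ_mul_div_two (n : ℕ) : (n + 1) * (n + 1 - 1) / 2 = n * (n - 1) / 2 + n := by
  rw [← Nat.choose_two_right, ← Nat.choose_two_right, Nat.choose_succ_succ' n 1,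
    Nat.choose_one_right, add_comm]

/-- The basis functions of the (p,q)-Baskakov operator. -/
noncomputable def baskakovWeight (p q x : ℝ) (n k : ℕ) : ℝ :=
  pqChoose p q (n + k - 1) k * p ^ (k + n * (n - 1) / 2) *
    q ^ (k * (k - 1) / 2) * (x ^ k / pqOnePlusPow p q x (n + k))

theorem baskakovWeight_nonneg {p q x : ℝ} (hq : 0 < q) (hqp : q < p) (hx : 0 ≤ x) (n k : ℕ) :
    0 ≤ baskakovWeight p q x n k := by
  have := hq.trans hqp
  have := pqOnePlusPow_pos hq hqp hx (n + k)
  have := pqFact_pos hq hqp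
  have h : 0 ≤ pqChoose p q (n + k - 1) k :=
    div_nonneg (this _).le (mul_pos (this _) (this _)).le
  unfold baskakovWeight
  positivity

theorem baskakovWeight_succ_right {p q x : ℝ} (hq : 0 < q) (hqp : q < p) (hx : 0 ≤ x)
    (m k : ℕ) :
    baskakovWeight p q x (m + 1) (k + 1) *
        (pqInt p q (k + 1) * (p ^ (m + 1 + k) + q ^ (m + 1 + k) * x)) =
      baskakovWeight p q x (m + 1) k * (pqInt p q (m + 1 + k) * (p * q ^ k * x)) := by
  have hP := (pqOnePlusPow_pos hq hqp hx (m + 1 + k)).ne'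
  have hP' := (pqOnePlusPow_pos hq hqp hx (m + 1 + k + 1)).ne'
  rw [pqOnePlusPow_succ] at hP'
  have hD := right_ne_zero_of_mul hP'
  have hF := fun j => (pqFact_pos hq hqp j).ne'
  have hI := (pqInt_pos hq hqp k.succ_ne_zero).ne'
  unfold baskakovWeight pqChoose
  rw [succ_mul_div_two k, ← add_assoc (m + 1) k 1, pqOnePlusPow_succ,
    show m + 1 + k + 1 - 1 = m + k + 1 by omega, show m + 1 + k - 1 = m + k by omega,
    show m + k + 1 - (k + 1) = m by omega, show m + k - k = m by omega]
  simp only [pqFact]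
  rw [show m + k + 1 = m + 1 + k by omega]
  have := hF k
  have := hF m
  field_simp
  ring

theorem baskakovWeight_succ_left {p q x : ℝ} (hq : 0 < q) (hqp : q < p) (hx : 0 ≤ x)
    (m k : ℕ) :
    baskakovWeight p q x (m + 2) k *
        (pqInt p q (m + 1) * (p ^ (m + 1 + k) + q ^ (m + 1 + k) * x)) =
      baskakovWeight p q x (m + 1) k * (pqInt p q (m + 1 + k) * p ^ (m + 1)) := by
  have hP := (pqOnePlusPow_pos hq hqp hx (m + 1 + k)).ne'
  have hP' := (pqOnePlusPow_pos hq hqp hx (m + 1 + k + 1)).ne'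
  rw [pqOnePlusPow_succ] at hP'
  have hD := right_ne_zero_of_mul hP'
  have hF := fun j => (pqFact_pos hq hqp j).ne'
  have hI := (pqInt_pos hq hqp m.succ_ne_zero).ne'
  unfold baskakovWeight pqChoose
  rw [succ_mul_div_two (m + 1), show m + 2 + k = m + 1 + k + 1 by omega, pqOnePlusPow_succ,
    show m + 1 + k + 1 - 1 = m + k + 1 by omega, show m + 1 + k - 1 = m + k by omega,
    show m + k + 1 - k = m + 1 by omega, show m + k - k = m by omega]
  simp only [pqFact]
  rw [show m + k + 1 = m + 1 + k by omega]
  have := hF k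
  have := hF m
  field_simp
  ring

theorem baskakovWeight_succ_mul_pqInt {p q x : ℝ} (hq : 0 < q) (hqp : q < p) (hx : 0 ≤ x)
    (m k : ℕ) :
    baskakovWeight p q x (m + 1) (k + 1) * (p ^ m * pqInt p q (k + 1)) =
      x * q ^ k * pqInt p q (m + 1) * baskakovWeight p q x (m + 2) k := by
  have hp := hq.trans hqp
  have hD : 0 < p ^ (m + 1 + k) + q ^ (m + 1 + k) * x := by positivity
  have hA := baskakovWeight_succ_right hq hqp hx m k
  have hB := baskakovWeight_succ_left hq hqp hx m k
  apply mul_right_cancel₀ hD.ne'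
  linear_combination p ^ m * hA - x * q ^ k * hB

theorem hasSum_of_telescope {w G : ℕ → ℝ} (hw : ∀ k, 0 ≤ w k) (hG : Tendsto G atTop (nhds 0))
    (h : ∀ k, w k = G k - G (k + 1)) : HasSum w (G 0) := by
  rw [hasSum_iff_tendsto_nat_of_nonneg hw]
  simp_rw [h, Finset.sum_range_sub']
  simpa using hG.const_sub (G 0)

theorem hasSum_baskakovWeight_one {p q x : ℝ} (hq : 0 < q) (hqp : q < p) (hx : 0 ≤ x) :
    HasSum (baskakovWeight p q x 1) 1 := by
  have hp := hq.trans hqp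
  have hw := baskakovWeight_nonneg hq hqp hx 1
  set w := baskakovWeight p q x 1 with hw_def
  have key (k : ℕ) : w (k + 1) * (p ^ (k + 1) + q ^ (k + 1) * x) = w k * (p * q ^ k * x) := by
    have h := baskakovWeight_succ_right hq hqp hx 0 k
    have hI := (pqInt_pos hq hqp k.succ_ne_zero).ne'
    rw [zero_add, add_comm 1 k] at h
    apply mul_left_cancel₀ hI
    linear_combination h
  set G : ℕ → ℝ := fun k => w k * (p ^ k + q ^ k * x) / p ^ k with hG_def
  have hG_succ (k : ℕ) : G (k + 1) = w k * ((q / p) ^ k * x) := by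
    simp only [hG_def]
    rw [key, div_pow, pow_succ]
    field_simp
  have hstep (k : ℕ) : w k = G k - G (k + 1) := by
    rw [hG_succ]
    simp only [hG_def, div_pow]
    field_simp
    ring
  have hG_nonneg (k : ℕ) : 0 ≤ G k := by
    have := hw k
    simp only [hG_def]
    positivity
  have hsum : Summable w := by
    refine summable_of_sum_range_le (c := G 0) hw fun n => ?_
    simp_rw [hstep, Finset.sum_range_sub']
    linarith [hG_nonneg n]
  have hG0 : G 0 = 1 := by
    have : 1 + x ≠ 0 := by positivity
    simp [hG_def, hw_def, baskakovWeight, pqChoose, pqFact, pqOnePlusPow, this]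
  have hG_lim : Tendsto G atTop (nhds 0) := by
    rw [← tendsto_add_atTop_iff_nat 1]
    simp_rw [hG_succ]
    have h := tendsto_pow_atTop_nhds_zero_of_lt_one (div_pos hq hp).le ((div_lt_one hp).2 hqp)
    simpa using hsum.tendsto_atTop_zero.mul (h.mul_const x)
  exact hG0 ▸ hasSum_of_telescope hw hG_lim hstep

theorem baskakovWeight_sub {p q x : ℝ} (hq : 0 < q) (hqp : q < p) (hx : 0 ≤ x) (m k : ℕ) :
    baskakovWeight p q x (m + 2) k - baskakovWeight p q x (m + 1) k =
      q ^ (m + 1) / pqInt p q (m + 1) *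
        (pqInt p q k / p ^ k * baskakovWeight p q x (m + 1) k -
          pqInt p q (k + 1) / p ^ (k + 1) * baskakovWeight p q x (m + 1) (k + 1)) := by
  have hp := hq.trans hqp
  have hD : 0 < p ^ (m + 1 + k) + q ^ (m + 1 + k) * x := by positivity
  have hI := (pqInt_pos hq hqp m.succ_ne_zero).ne'
  have hB := baskakovWeight_succ_left hq hqp hx m k
  have hC := baskakovWeight_succ_mul_pqInt hq hqp hx m k
  have hadd := pqInt_add hqp k (m + 1)
  rw [add_comm k] at hadd
  rw [hadd] at hB
  have hC' : pqInt p q (k + 1) * baskakovWeight p q x (m + 1) (k + 1) =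
      x * q ^ k * pqInt p q (m + 1) * baskakovWeight p q x (m + 2) k / p ^ m := by
    rw [eq_div_iff (pow_pos hp m).ne']
    linear_combination hC
  rw [div_mul_eq_mul_div (pqInt p q (k + 1)), hC']
  field_simp
  ring_nf at hB ⊢
  linear_combination p ^ k * hB

theorem hasSum_baskakovWeight {p q x : ℝ} (hq : 0 < q) (hqp : q < p) (hx : 0 ≤ x) (m : ℕ) :
    HasSum (baskakovWeight p q x (m + 1)) 1 := by
  have hp := hq.trans hqp
  induction m with
  | zero => exact hasSum_baskakovWeight_one hq hqp hx
  | succ m ih =>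
    have hw := baskakovWeight_nonneg hq hqp hx (m + 1)
    set G : ℕ → ℝ := fun k => pqInt p q k / p ^ k * baskakovWeight p q x (m + 1) k with hG_def
    have hbound (k : ℕ) : pqInt p q k / p ^ k ≤ 1 / (p - q) := by
      have := sub_pos.2 hqp
      unfold pqInt
      rw [div_div, div_le_div_iff₀ (by positivity) this]
      nlinarith [pow_pos hq k]
    have hG_lim : Tendsto G atTop (nhds 0) := by
      refine squeeze_zero
        (fun k => mul_nonneg (div_nonneg (pqInt_nonneg hq hqp k) (pow_pos hp k).le) (hw k))
        (fun k => mul_le_mul_of_nonneg_right (hbound k) (hw k)) ?_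
      simpa using ih.summable.tendsto_atTop_zero.const_mul (1 / (p - q))
    rw [hasSum_iff_tendsto_nat_of_nonneg (baskakovWeight_nonneg hq hqp hx _)]
    have hpart (N : ℕ) : ∑ k ∈ Finset.range N, baskakovWeight p q x (m + 1 + 1) k =
        ∑ k ∈ Finset.range N, baskakovWeight p q x (m + 1) k +
          q ^ (m + 1) / pqInt p q (m + 1) * (G 0 - G N) := by
      rw [← Finset.sum_range_sub', Finset.mul_sum, ← Finset.sum_add_distrib]
      refine Finset.sum_congr rfl fun k _ => ?_
      rw [← baskakovWeight_sub hq hqp hx m k]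
      ring
    have hG0 : G 0 = 0 := by simp [hG_def, pqInt_zero]
    simp_rw [hpart, hG0]
    simpa using ih.tendsto_sum_nat.add
      ((hG_lim.const_sub 0).const_mul (q ^ (m + 1) / pqInt p q (m + 1)))

theorem hasSum_baskakovWeight_mul_pqInt {p q x : ℝ} (hq : 0 < q) (hqp : q < p) (hx : 0 ≤ x)
    (m : ℕ) :
    HasSum (fun k => baskakovWeight p q x (m + 1) k * (pqInt p q k / q ^ k))
      (x * pqInt p q (m + 1) / (q * p ^ m)) := by
  have hp := hq.trans hqp
  rw [← hasSum_nat_add_iff' 1]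
  have h := (hasSum_baskakovWeight hq hqp hx (m + 1)).mul_left
    (x * pqInt p q (m + 1) / (q * p ^ m))
  simp only [Finset.sum_range_one, pqInt_zero, zero_div, mul_zero, sub_zero]
  rw [mul_one] at h
  refine (congrArg (HasSum · _) (funext fun k => ?_)).mpr h
  have hC := baskakovWeight_succ_mul_pqInt hq hqp hx m k
  field_simp
  rw [pow_succ]
  linear_combination q * hC

theorem hasSum_baskakovWeight_mul_sq {p q x : ℝ} (hq : 0 < q) (hqp : q < p) (hx : 0 ≤ x)
    (m : ℕ) :
    HasSum (fun k => baskakovWeight p q x (m + 1) k *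
        (p ^ m * pqInt p q k / (q ^ (k - 1) * pqInt p q (m + 1))) ^ 2)
      (x ^ 2 + p ^ m * x / pqInt p q (m + 1) * (1 + p / q * x)) := by
  have hp := hq.trans hqp
  have hI := (pqInt_pos hq hqp m.succ_ne_zero).ne'
  rw [← hasSum_nat_add_iff' 1]
  have h := ((hasSum_baskakovWeight hq hqp hx (m + 1)).add
    ((hasSum_baskakovWeight_mul_pqInt hq hqp hx (m + 1)).mul_left p)).mul_left
    (p ^ m * x / pqInt p q (m + 1))
  simp only [Finset.sum_range_one, pqInt_zero, zero_div, mul_zero, sub_zero, ne_eq,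
    OfNat.ofNat_ne_zero, not_false_eq_true, zero_pow, Nat.add_sub_cancel]
  have hsum : x ^ 2 + p ^ m * x / pqInt p q (m + 1) * (1 + p / q * x) =
      p ^ m * x / pqInt p q (m + 1) *
        (1 + p * (x * pqInt p q (m + 1 + 1) / (q * p ^ (m + 1)))) := by
    have hadd := pqInt_add hqp (m + 1) 1
    rw [pqInt_one hqp] at hadd
    rw [hadd]
    field_simp
    ring
  rw [hsum]
  refine (congrArg (HasSum · _) (funext fun k => ?_)).mpr h
  have hC := baskakovWeight_succ_mul_pqInt hq hqp hx m k
  have hadd := pqInt_add hqp 1 k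
  rw [add_comm 1 k, pqInt_one hqp] at hadd
  calc _ = baskakovWeight p q x (m + 1) (k + 1) * (p ^ m * pqInt p q (k + 1)) *
        (p ^ m * pqInt p q (k + 1)) / (q ^ k * pqInt p q (m + 1)) ^ 2 := by ring
    _ = _ := by
      rw [hC, hadd]
      field_simp
      ring

theorem baskakov_sq (p q : ℝ) (n : ℕ) (x : ℝ)
    (hq : 0 < q) (hqp : q < p) (hp : p ≤ 1) (hn : 1 ≤ n) (hx : 0 ≤ x) :
    baskakov p q n (fun t => t ^ 2) x
      = x ^ 2 + p ^ (n - 1) * x / pqInt p q n * (1 + p / q * x) := by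
  obtain ⟨m, rfl⟩ := Nat.exists_eq_add_of_le' hn
  exact (hasSum_baskakovWeight_mul_sq hq hqp hx m).tsum_eq
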